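/- Let U ⊆ ℝⁿ be open and let 𝓛 be an even mixed form of codegree k and additional degree r on U. Then its differential Δ𝓛, defined by Δ𝓛(x, p, ŵ) := (−1)^r Σ_{K=1}^{k} Σ_{A=1}^{n} w'^K (∂²𝓛/∂x^A∂p_A^K)(x, p, w) for ŵ ∈ Matrix((r+1)×k, ℝ) with first r rows w and last row w', is an even mixed form of codegree k and additional degree r+1 on U, and Δ(Δ𝓛) = 0. -/

import Mathlib

open MeasureTheory
open scoped BigOperators

noncomputable section

/-- Product of matrices given as functions (entry `(i,k)` is `∑ j, M i j * N j k`). -/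
def mmul {a b c : ℕ} (M : Fin a → Fin b → ℝ) (N : Fin b → Fin c → ℝ) :
    Fin a → Fin c → ℝ :=
  fun i k => ∑ j, M i j * N j k

/-- Determinant of a square matrix given as a function. -/
def fdet {a : ℕ} (M : Fin a → Fin a → ℝ) : ℝ :=
  Matrix.det (Matrix.of M)

/-- Partial derivative of a function of a matrix with respect to the `(i,j)` entry. -/
def pdM {a b : ℕ} (L : (Fin a → Fin b → ℝ) → ℝ) (i : Fin a) (j : Fin b)
    (m : Fin a → Fin b → ℝ) : ℝ :=
  deriv (fun t : ℝ => L (fun i' j' => m i' j' + (if i' = i ∧ j' = j then t else 0))) 0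

/-- Partial derivative of a function of a vector with respect to the `i`-th coordinate. -/
def pdV {a : ℕ} (f : (Fin a → ℝ) → ℝ) (i : Fin a) (x : Fin a → ℝ) : ℝ :=
  deriv (fun t : ℝ => f (fun i' => x i' + (if i' = i then t else 0))) 0

/-- The fundamental equations for a function of an `a × b` matrix:
for all rows `i₁, i₂` and columns `j₁, j₂`,
`∂²L/∂m_{i₁}^{j₁}∂m_{i₂}^{j₂} + ∂²L/∂m_{i₂}^{j₁}∂m_{i₁}^{j₂} = 0`. -/
def FundEqs {a b : ℕ} (L : (Fin a → Fin b → ℝ) → ℝ) : Prop :=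
  ∀ (i₁ i₂ : Fin a) (j₁ j₂ : Fin b) (m : Fin a → Fin b → ℝ),
    pdM (fun m' => pdM L i₂ j₂ m') i₁ j₁ m + pdM (fun m' => pdM L i₁ j₂ m') i₂ j₁ m = 0

/-- The velocity matrix of a path `γ`: `(vel γ t) F A = ∂γ^A/∂t^F (t)`. -/
def vel {r n : ℕ} (γ : (Fin r → ℝ) → (Fin n → ℝ)) (t : Fin r → ℝ) :
    Fin r → Fin n → ℝ :=
  fun F A => pdV (fun s => γ s A) F t

/-- The matrix of gradients of a copath `f`: `(grad f x) A K = ∂f^K/∂x^A (x)`. -/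
def grad {n k : ℕ} (f : (Fin n → ℝ) → (Fin k → ℝ)) (x : Fin n → ℝ) :
    Fin n → Fin k → ℝ :=
  fun A K => pdV (fun y => f y K) A x

/-- An even `r`-form on an open set `U ⊆ ℝⁿ`: a smooth function `L(x, ẋ)` of a point
`x` and an `r × n` matrix `ẋ` which is covariant (`L(x, h·ẋ) = det h · L(x, ẋ)` for
invertible `h`) and satisfies the fundamental equations in the entries of `ẋ`. -/
def IsEvenForm {n r : ℕ} (U : Set (Fin n → ℝ))
    (L : (Fin n → ℝ) → (Fin r → Fin n → ℝ) → ℝ) : Prop :=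
  ContDiffOn ℝ (⊤ : ℕ∞)
      (fun q : (Fin n → ℝ) × (Fin r → Fin n → ℝ) => L q.1 q.2)
      (U ×ˢ (Set.univ : Set (Fin r → Fin n → ℝ))) ∧
  (∀ x ∈ U, ∀ (xdot : Fin r → Fin n → ℝ) (h : Fin r → Fin r → ℝ), fdet h ≠ 0 →
    L x (mmul h xdot) = fdet h * L x xdot) ∧
  (∀ x ∈ U, FundEqs (L x))

/-- The differential of a Lagrangian of paths `L(x, ẋ)`:
`ΔL(x, (ẋ; ẏ)) = (−1)^r Σ_A ẏ^A (∂L/∂x^A − Σ_{F,B} ẋ_F^B ∂²L/∂x^B∂ẋ_F^A)`,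
where `ẋ` consists of the first `r` rows and `ẏ` is the last row of the argument. -/
def Dform {n r : ℕ} (L : (Fin n → ℝ) → (Fin r → Fin n → ℝ) → ℝ) :
    (Fin n → ℝ) → (Fin (r + 1) → Fin n → ℝ) → ℝ :=
  fun x M => (-1 : ℝ) ^ r * ∑ A, M (Fin.last r) A *
    (pdV (fun x' => L x' (fun F => M (Fin.castSucc F))) A x
      - ∑ F, ∑ B, M (Fin.castSucc F) B *
          pdV (fun x' => pdM (L x') F A (fun G => M (Fin.castSucc G))) B x)

/-- An even mixed form of codegree `k` and additional degree `r` on an open set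
`U ⊆ ℝⁿ`: a smooth function `𝓛(x, p, w)` which is right-covariant, left-covariant,
admissible, and satisfies the fundamental equations in the entries of the stacked
`(n+r) × k` matrix (`p` over `w`). -/
def IsMixedForm {n k r : ℕ} (U : Set (Fin n → ℝ))
    (L : (Fin n → ℝ) → (Fin n → Fin k → ℝ) → (Fin r → Fin k → ℝ) → ℝ) : Prop :=
  ContDiffOn ℝ (⊤ : ℕ∞)
      (fun q : (Fin n → ℝ) × (Fin n → Fin k → ℝ) × (Fin r → Fin k → ℝ) =>
        L q.1 q.2.1 q.2.2)
      (U ×ˢ (Set.univ : Set ((Fin n → Fin k → ℝ) × (Fin r → Fin k → ℝ)))) ∧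
  (∀ x ∈ U, ∀ (p : Fin n → Fin k → ℝ) (w : Fin r → Fin k → ℝ) (g : Fin k → Fin k → ℝ),
    fdet g ≠ 0 → L x (mmul p g) (mmul w g) = fdet g * L x p w) ∧
  (∀ x ∈ U, ∀ (p : Fin n → Fin k → ℝ) (w : Fin r → Fin k → ℝ) (h : Fin r → Fin r → ℝ),
    fdet h ≠ 0 → L x p (mmul h w) = fdet h * L x p w) ∧
  (∀ x ∈ U, ∀ (p : Fin n → Fin k → ℝ) (w : Fin r → Fin k → ℝ) (a : Fin n → Fin r → ℝ),
    L x (p + mmul a w) w = L x p w) ∧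
  (∀ x ∈ U, FundEqs (fun m : Fin (n + r) → Fin k → ℝ =>
    L x (fun A => m (Fin.castAdd r A)) (fun F => m (Fin.natAdd n F))))

/-- The differential of a mixed Lagrangian `𝓛(x, p, w)`:
`Δ𝓛(x, p, ŵ) = (−1)^r Σ_{K,A} w'^K ∂²𝓛/∂x^A∂p_A^K (x, p, w)`, where `ŵ` has first
`r` rows `w` and last row `w'`. -/
def Dmix {n k r : ℕ}
    (L : (Fin n → ℝ) → (Fin n → Fin k → ℝ) → (Fin r → Fin k → ℝ) → ℝ) :
    (Fin n → ℝ) → (Fin n → Fin k → ℝ) → (Fin (r + 1) → Fin k → ℝ) → ℝ :=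
  fun x p what => (-1 : ℝ) ^ r * ∑ K, ∑ A, what (Fin.last r) K *
    pdV (fun x' => pdM (fun p' => L x' p' (fun F => what (Fin.castSucc F))) A K p) A x

/-- An even dual form of codegree `k` on an open set `U ⊆ ℝⁿ`: a smooth function
`𝓛(x, p)` of a point `x` and an `n × k` matrix `p` of momenta which is covariant
(`𝓛(x, p·g) = det g · 𝓛(x, p)` for invertible `g`) and satisfies the fundamental
equations in the entries of `p`. -/
def IsDualForm {n k : ℕ} (U : Set (Fin n → ℝ))
    (L : (Fin n → ℝ) → (Fin n → Fin k → ℝ) → ℝ) : Prop :=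
  ContDiffOn ℝ (⊤ : ℕ∞)
      (fun q : (Fin n → ℝ) × (Fin n → Fin k → ℝ) => L q.1 q.2)
      (U ×ˢ (Set.univ : Set (Fin n → Fin k → ℝ))) ∧
  (∀ x ∈ U, ∀ (p : Fin n → Fin k → ℝ) (g : Fin k → Fin k → ℝ), fdet g ≠ 0 →
    L x (mmul p g) = fdet g * L x p) ∧
  (∀ x ∈ U, FundEqs (L x))

/-- The identity matrix as a function. -/
def idm (n : ℕ) : Fin n → Fin n → ℝ := fun i j => if i = j then 1 else 0

/-- The increment of `f` when the vector `v` is added to the `i`-th row of its argument. -/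
def rowDiff {a b : ℕ} (f : (Fin a → Fin b → ℝ) → ℝ) (i : Fin a) (v : Fin b → ℝ)
    (m : Fin a → Fin b → ℝ) : ℝ :=
  f (m + Pi.single i v) - f m

/-- The finite-difference form of the fundamental equations: row increments are homogeneous
in the increment, and second increments are skew-symmetric in the two rows. -/
structure RowAlternating {a b : ℕ} (f : (Fin a → Fin b → ℝ) → ℝ) : Prop where
  smul : ∀ m i (c : ℝ) v, rowDiff f i (c • v) m = c * rowDiff f i v m
  alt : ∀ m i j u v, rowDiff (rowDiff f j u) i v m + rowDiff (rowDiff f i u) j v m = 0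

lemma pdM_eq_deriv {a b : ℕ} (f : (Fin a → Fin b → ℝ) → ℝ) (i : Fin a) (j : Fin b)
    (m : Fin a → Fin b → ℝ) :
    pdM f i j m = deriv (fun t : ℝ => f (m + Pi.single i (t • Pi.single j 1))) 0 := by
  unfold pdM
  congr 1
  funext t
  congr 1
  funext i' j'
  by_cases hi : i' = i
  · subst hi
    by_cases hj : j' = j
    · subst hj; simp
    · simp [hj]
  · simp [hi]

lemma pdV_eq_deriv {a : ℕ} (f : (Fin a → ℝ) → ℝ) (i : Fin a) (x : Fin a → ℝ) :
    pdV f i x = deriv (fun t : ℝ => f (x + t • Pi.single i 1)) 0 := by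
  unfold pdV
  congr 1
  funext t
  congr 1
  funext i'
  by_cases hi : i' = i
  · subst hi; simp
  · simp [hi]

lemma init_add_single_castSucc {a b : ℕ} (M : Fin (a + 1) → Fin b → ℝ) (j : Fin a)
    (v : Fin b → ℝ) :
    (fun l : Fin a => (M + Pi.single j.castSucc v : Fin (a + 1) → Fin b → ℝ) l.castSucc) =
      (fun l => M l.castSucc) + Pi.single j v := by
  funext l
  by_cases h : l = j
  · subst h; simp
  · simp [h]

lemma init_add_single_last {a b : ℕ} (M : Fin (a + 1) → Fin b → ℝ) (v : Fin b → ℝ) :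
    (fun l : Fin a => (M + Pi.single (Fin.last a) v : Fin (a + 1) → Fin b → ℝ) l.castSucc) =
      fun l => M l.castSucc := by
  funext l
  simp [(Fin.castSucc_lt_last l).ne]

lemma rowDiff_comm {a b : ℕ} (f : (Fin a → Fin b → ℝ) → ℝ) (i j : Fin a)
    (u v : Fin b → ℝ) (m : Fin a → Fin b → ℝ) :
    rowDiff (rowDiff f i u) j v m = rowDiff (rowDiff f j v) i u m := by
  simp only [rowDiff, add_right_comm m (Pi.single (M := fun _ => Fin b → ℝ) i u)]
  ring

namespace RowAlternating

variable {a b : ℕ} {f : (Fin a → Fin b → ℝ) → ℝ}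

lemma rowDiff_self (hf : RowAlternating f) (m : Fin a → Fin b → ℝ) (i j : Fin a)
    (v : Fin b → ℝ) : rowDiff (rowDiff f j v) i v m = 0 := by
  have h := hf.alt m i j v v
  rw [rowDiff_comm f i] at h
  linarith

lemma rowDiff_add_single (hf : RowAlternating f) (m : Fin a → Fin b → ℝ) (i : Fin a)
    (u v : Fin b → ℝ) : rowDiff f i u (m + Pi.single i v) = rowDiff f i u m := by
  have h := hf.alt m i i u v
  rw [← two_mul] at h
  exact sub_eq_zero.1 ((mul_eq_zero.1 h).resolve_left two_ne_zero)

lemma rowDiff_add (hf : RowAlternating f) (m : Fin a → Fin b → ℝ) (i : Fin a)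
    (u v : Fin b → ℝ) : rowDiff f i (u + v) m = rowDiff f i u m + rowDiff f i v m := by
  rw [← hf.rowDiff_add_single m i u v]
  simp only [rowDiff, add_comm u v, Pi.single_add, add_assoc]
  ring

lemma pdM_eq_rowDiff (hf : RowAlternating f) (i : Fin a) (j : Fin b)
    (m : Fin a → Fin b → ℝ) : pdM f i j m = rowDiff f i (Pi.single j 1) m := by
  have h : (fun t : ℝ => f (m + Pi.single i (t • Pi.single j 1))) =
      fun t => f m + t * rowDiff f i (Pi.single j 1) m := by
    funext t
    rw [← hf.smul m i t, rowDiff]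
    ring
  rw [pdM_eq_deriv, h]
  simp

lemma rowDiff_eq_sum (hf : RowAlternating f) (i : Fin a) (v : Fin b → ℝ)
    (m : Fin a → Fin b → ℝ) :
    rowDiff f i v m = ∑ j, v j * rowDiff f i (Pi.single j 1) m := by
  let ℓ : (Fin b → ℝ) →ₗ[ℝ] ℝ :=
    { toFun := fun v => rowDiff f i v m
      map_add' := hf.rowDiff_add m i
      map_smul' := hf.smul m i }
  have h := LinearMap.pi_apply_eq_sum_univ ℓ v
  have e : ∀ j, (fun l => if j = l then (1 : ℝ) else 0) = (Pi.single j 1 : Fin b → ℝ) := by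
    intro j
    funext l
    simp [Pi.single_apply, eq_comm]
  simpa [ℓ, e] using h

lemma increment (hf : RowAlternating f) (i : Fin a) (v : Fin b → ℝ) :
    RowAlternating (rowDiff f i v) where
  smul m j c u := by
    have h₁ := hf.smul (m + Pi.single i v) j c u
    have h₂ := hf.smul m j c u
    rw [rowDiff_comm f i, rowDiff_comm f i, rowDiff, rowDiff.eq_1 (rowDiff f j u), h₁, h₂]
    ring
  alt m j l u w := by
    have h₁ := hf.alt (m + Pi.single i v) j l u w
    have h₂ := hf.alt m j l u w
    have e : ∀ l u, rowDiff (rowDiff f i v) l u = rowDiff (rowDiff f l u) i v :=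
      fun l u => funext (rowDiff_comm f i l v u)
    rw [e, e, rowDiff_comm _ i, rowDiff_comm _ i, rowDiff, rowDiff.eq_1 _ i v m]
    linarith

lemma fundEqs (hf : RowAlternating f) : FundEqs f := by
  intro i₁ i₂ j₁ j₂ m
  have h : ∀ i j, (fun m' => pdM f i j m') = rowDiff f i (Pi.single j 1) :=
    fun i j => funext (hf.pdM_eq_rowDiff i j)
  rw [h, h, (hf.increment _ _).pdM_eq_rowDiff, (hf.increment _ _).pdM_eq_rowDiff]
  exact hf.alt m i₁ i₂ _ _

lemma rowDiff_add_single_smul (hf : RowAlternating f) (m : Fin a → Fin b → ℝ) (i j : Fin a)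
    (v : Fin b → ℝ) (c : ℝ) :
    rowDiff f i v (m + Pi.single j (c • v)) = rowDiff f i v m := by
  have h := (hf.increment i v).smul m j c v
  rw [hf.rowDiff_self, mul_zero] at h
  exact sub_eq_zero.1 h

/-- An increment along `v` does not change when multiples of `v` are added to the rows. -/
lemma rowDiff_add_smul (hf : RowAlternating f) (m : Fin a → Fin b → ℝ) (i : Fin a)
    (v : Fin b → ℝ) (c : Fin a → ℝ) :
    rowDiff f i v (m + fun j => c j • v) = rowDiff f i v m := by
  have key : ∀ s : Finset (Fin a), rowDiff f i v
      (m + ∑ j ∈ s, Pi.single j (c j • v)) = rowDiff f i v m := by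
    intro s
    induction s using Finset.induction_on with
    | empty => simp
    | insert j s hj ih =>
      rw [Finset.sum_insert hj, add_comm (Pi.single j _), ← add_assoc,
        hf.rowDiff_add_single_smul, ih]
  rw [← key Finset.univ, Finset.univ_sum_single fun j => c j • v]

/-- The increment of the `i`-th row along an additional last row is row-alternating in the
enlarged matrix. -/
lemma extend (hf : RowAlternating f) (i : Fin a) :
    RowAlternating (fun M : Fin (a + 1) → Fin b → ℝ =>
      rowDiff f i (M (Fin.last a)) (fun l => M l.castSucc)) := by
  set T := fun M : Fin (a + 1) → Fin b → ℝ =>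
    rowDiff f i (M (Fin.last a)) (fun l => M l.castSucc) with hT
  have dlast : ∀ u M, rowDiff T (Fin.last a) u M = rowDiff f i u (fun l => M l.castSucc) := by
    intro u M
    change rowDiff f i ((M + Pi.single (Fin.last a) u : Fin (a + 1) → Fin b → ℝ) (Fin.last a))
        (fun l => (M + Pi.single (Fin.last a) u : Fin (a + 1) → Fin b → ℝ) l.castSucc) -
      rowDiff f i (M (Fin.last a)) (fun l => M l.castSucc) = _
    rw [init_add_single_last, Pi.add_apply, Pi.single_eq_same, hf.rowDiff_add, add_sub_cancel_left]
  have dcast : ∀ j u M, rowDiff T (Fin.castSucc j) u M =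
      rowDiff (rowDiff f i (M (Fin.last a))) j u (fun l => M l.castSucc) := by
    intro j u M
    rw [rowDiff, rowDiff, hT]
    simp only [init_add_single_castSucc]
    simp [(Fin.castSucc_lt_last j).ne']
  have dlast_last : ∀ u v M, rowDiff (rowDiff T (Fin.last a) u) (Fin.last a) v M = 0 := by
    intro u v M
    rw [rowDiff, dlast, dlast, init_add_single_last, sub_self]
  have dlast_cast : ∀ u v j M, rowDiff (rowDiff T (Fin.last a) u) (Fin.castSucc j) v M =
      rowDiff (rowDiff f i u) j v (fun l => M l.castSucc) := by
    intro u v j M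
    rw [rowDiff, dlast, dlast, init_add_single_castSucc, rowDiff.eq_1 (rowDiff f i u)]
  have alt' : ∀ (m : Fin a → Fin b → ℝ) l u v,
      rowDiff (rowDiff f i v) l u m + rowDiff (rowDiff f i u) l v m = 0 := by
    intro m l u v
    rw [rowDiff_comm f i l u v]
    exact hf.alt m l i v u
  refine ⟨fun M j c v => ?_, fun M j l u v => ?_⟩
  · induction j using Fin.lastCases with
    | last => rw [dlast, dlast, hf.smul]
    | cast j => rw [dcast, dcast, (hf.increment _ _).smul]
  · induction j using Fin.lastCases with
    | last =>
      induction l using Fin.lastCases with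
      | last => rw [dlast_last, add_zero]
      | cast l =>
        rw [rowDiff_comm T, dlast_cast, dlast_cast]
        exact alt' _ l u v
    | cast j =>
      induction l using Fin.lastCases with
      | last =>
        rw [rowDiff_comm T j.castSucc, dlast_cast, dlast_cast]
        exact alt' _ j v u
      | cast l =>
        have h : ∀ p q (w z : Fin b → ℝ), rowDiff (rowDiff T (Fin.castSucc p) w) q.castSucc z M =
            rowDiff (rowDiff (rowDiff f i (M (Fin.last a))) p w) q z
              (fun l => M l.castSucc) := by
          intro p q w z
          rw [rowDiff, dcast, dcast, init_add_single_castSucc, rowDiff.eq_1 (rowDiff (rowDiff f i _) p w)]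
          simp [(Fin.castSucc_lt_last q).ne']
        rw [h, h]
        exact (hf.increment _ _).alt _ j l u v

end RowAlternating

lemma pdM_eq_fderiv {a b : ℕ} {f : (Fin a → Fin b → ℝ) → ℝ} {m : Fin a → Fin b → ℝ}
    (hf : DifferentiableAt ℝ f m) (i : Fin a) (j : Fin b) :
    pdM f i j m = fderiv ℝ f m (Pi.single i (Pi.single j 1)) := by
  rw [pdM_eq_deriv, ← hf.lineDeriv_eq_fderiv, lineDeriv]
  simp only [Pi.single_smul]

lemma sub_eq_fderiv_of_second_eq_zero {E : Type*} [NormedAddCommGroup E] [NormedSpace ℝ E]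
    {f : E → ℝ} (hf : ContDiff ℝ 2 f) (e : E)
    (h : ∀ m, fderiv ℝ (fderiv ℝ f) m e e = 0) (m : E) :
    f (m + e) - f m = fderiv ℝ f m e := by
  have hd : Differentiable ℝ f := hf.differentiable (by norm_num)
  have hd' : Differentiable ℝ (fderiv ℝ f) :=
    (hf.fderiv_right (m := 1) (by norm_num)).differentiable (by norm_num)
  have hline : ∀ t : ℝ, HasDerivAt (fun t : ℝ => m + t • e) e t := fun t => by
    simpa using ((hasDerivAt_id t).smul_const e).const_add m
  have h₁ : ∀ t, HasDerivAt (fun t : ℝ => f (m + t • e)) (fderiv ℝ f (m + t • e) e) t :=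
    fun t => (hd _).hasFDerivAt.comp_hasDerivAt t (hline t)
  have h₂ : ∀ t, HasDerivAt (fun t : ℝ => fderiv ℝ f (m + t • e) e) 0 t := fun t => by
    simpa [h] using ((hd' _).hasFDerivAt.comp_hasDerivAt t (hline t)).clm_apply
      (hasDerivAt_const t e)
  have hc : ∀ t, fderiv ℝ f (m + t • e) e = fderiv ℝ f m e := fun t => by
    simpa using is_const_of_deriv_eq_zero (fun t => (h₂ t).differentiableAt)
      (fun t => (h₂ t).deriv) t 0
  have h₃ : ∀ t, HasDerivAt (fun t : ℝ => f (m + t • e) - t * fderiv ℝ f m e) 0 t := fun t => by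
    refine ((h₁ t).sub ((hasDerivAt_id t).mul_const (fderiv ℝ f m e))).congr_deriv ?_
    rw [hc, one_mul, sub_self]
  have := is_const_of_deriv_eq_zero (fun t => (h₃ t).differentiableAt) (fun t => (h₃ t).deriv) 1 0
  simp only [one_smul, one_mul, zero_smul, add_zero, zero_mul, sub_zero] at this
  linarith

lemma FundEqs.fderiv_fderiv {a b : ℕ} {f : (Fin a → Fin b → ℝ) → ℝ} (h : FundEqs f)
    (hf : ContDiff ℝ 2 f) (m : Fin a → Fin b → ℝ) (i j : Fin a) (v u : Fin b → ℝ) :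
    fderiv ℝ (fderiv ℝ f) m (Pi.single i v) (Pi.single j u) +
      fderiv ℝ (fderiv ℝ f) m (Pi.single j v) (Pi.single i u) = 0 := by
  have hd : Differentiable ℝ f := hf.differentiable (by norm_num)
  have hd' : Differentiable ℝ (fderiv ℝ f) :=
    (hf.fderiv_right (m := 1) (by norm_num)).differentiable (by norm_num)
  let φ : (Fin b → ℝ) →ₗ[ℝ] (Fin b → ℝ) →ₗ[ℝ] ℝ := LinearMap.mk₂ ℝ
    (fun v u => fderiv ℝ (fderiv ℝ f) m (Pi.single i v) (Pi.single j u) +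
      fderiv ℝ (fderiv ℝ f) m (Pi.single j v) (Pi.single i u))
    (fun _ _ _ => by simp only [Pi.single_add, map_add, add_apply]; ring)
    (fun _ _ _ => by simp only [Pi.single_smul, map_smul, smul_apply, smul_add])
    (fun _ _ _ => by simp only [Pi.single_add, map_add]; ring)
    (fun _ _ _ => by simp only [Pi.single_smul, map_smul, smul_add])
  have hpd : ∀ i k, (fun m' => pdM f i k m') =
      fun m' => fderiv ℝ f m' (Pi.single i (Pi.single k 1)) :=
    fun i k => funext fun m' => pdM_eq_fderiv (hd m') i k
  have hpd₂ : ∀ i j k l, pdM (fun m' => pdM f j l m') i k m =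
      fderiv ℝ (fderiv ℝ f) m (Pi.single i (Pi.single k 1)) (Pi.single j (Pi.single l 1)) := by
    intro i j k l
    rw [hpd, pdM_eq_fderiv ((hd' m).clm_apply (differentiableAt_const _)),
      fderiv_clm_apply (hd' m) (differentiableAt_const _)]
    simp
  have hφ : φ = 0 := by
    refine LinearMap.ext_basis (Pi.basisFun ℝ _) (Pi.basisFun ℝ _) fun k l => ?_
    have := h i j k l m
    rw [hpd₂, hpd₂] at this
    simpa [φ] using this
  exact congrArg (fun ψ : (Fin b → ℝ) →ₗ[ℝ] (Fin b → ℝ) →ₗ[ℝ] ℝ => ψ v u) hφ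

lemma FundEqs.rowAlternating {a b : ℕ} {f : (Fin a → Fin b → ℝ) → ℝ} (h : FundEqs f)
    (hf : ContDiff ℝ 2 f) : RowAlternating f := by
  have hd : Differentiable ℝ f := hf.differentiable (by norm_num)
  have hd' : Differentiable ℝ (fderiv ℝ f) :=
    (hf.fderiv_right (m := 1) (by norm_num)).differentiable (by norm_num)
  have hrow : ∀ i v, rowDiff f i v = fun m => fderiv ℝ f m (Pi.single i v) := by
    intro i v
    funext m
    refine sub_eq_fderiv_of_second_eq_zero hf _ (fun m => ?_) m
    have := h.fderiv_fderiv hf m i i v v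
    linarith
  have hrow₂ : ∀ i j u v m, rowDiff (rowDiff f j u) i v m =
      fderiv ℝ (fderiv ℝ f) m (Pi.single i v) (Pi.single j u) := by
    intro i j u v m
    have e : fderiv ℝ (rowDiff f j u) m = fderiv ℝ f (m + Pi.single j u) - fderiv ℝ f m := by
      rw [← fderiv_comp_add_right (f := f) (x := m) (Pi.single j u)]
      exact fderiv_sub ((hd _).comp m (differentiableAt_id.add_const _)) (hd m)
    rw [rowDiff_comm, rowDiff, hrow, ← sub_apply, ← e, hrow,
      fderiv_clm_apply (hd' m) (differentiableAt_const _)]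
    simp
  refine ⟨fun m i c v => ?_, fun m i j u v => ?_⟩
  · simp only [hrow, Pi.single_smul, map_smul, smul_eq_mul]
  · rw [hrow₂, hrow₂]
    exact h.fderiv_fderiv hf m i j v u

/-- A function of `p` and `w` as a function of the stacked matrix (`p` over `w`). -/
def stack {n k r : ℕ} (f : (Fin n → Fin k → ℝ) → (Fin r → Fin k → ℝ) → ℝ)
    (m : Fin (n + r) → Fin k → ℝ) : ℝ :=
  f (fun A => m (Fin.castAdd r A)) (fun F => m (Fin.natAdd n F))

/-- The algebraic conditions of a mixed form at a fixed base point, with left-covariance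
expressed on diagonal matrices and transvections. -/
structure MixedAlternating {n k r : ℕ}
    (f : (Fin n → Fin k → ℝ) → (Fin r → Fin k → ℝ) → ℝ) : Prop where
  right : ∀ p w g, fdet g ≠ 0 → f (mmul p g) (mmul w g) = fdet g * f p w
  diag : ∀ p w (d : Fin r → ℝ), (∀ i, d i ≠ 0) → f p (fun i => d i • w i) = (∏ i, d i) * f p w
  transvec : ∀ p (w : Fin r → Fin k → ℝ) i j (c : ℝ), i ≠ j → f p (w + Pi.single i (c • w j)) = f p w
  admissible : ∀ p w a, f (p + mmul a w) w = f p w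
  row : RowAlternating (stack f)

/-- The increment of `f` when the last row of `w` is added to the `A`-th row of `p`. -/
def momentumDiff {n k r : ℕ} (f : (Fin n → Fin k → ℝ) → (Fin r → Fin k → ℝ) → ℝ) (A : Fin n)
    (p : Fin n → Fin k → ℝ) (w : Fin (r + 1) → Fin k → ℝ) : ℝ :=
  rowDiff (fun p' => f p' (fun F => w (Fin.castSucc F))) A (w (Fin.last r)) p

lemma stack_append {n k r : ℕ} (f : (Fin n → Fin k → ℝ) → (Fin r → Fin k → ℝ) → ℝ)
    (p : Fin n → Fin k → ℝ) (w : Fin r → Fin k → ℝ) : stack f (Fin.append p w) = f p w := by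
  simp [stack]

lemma append_add_single_castAdd {n k r : ℕ} (p : Fin n → Fin k → ℝ) (w : Fin r → Fin k → ℝ)
    (A : Fin n) (v : Fin k → ℝ) :
    Fin.append p w + Pi.single (Fin.castAdd r A) v = Fin.append (p + Pi.single A v) w := by
  funext l
  induction l using Fin.addCases with
  | left l =>
    by_cases h : l = A
    · subst h; simp
    · simp [h]
  | right l => simp [Pi.single_apply, Fin.ext_iff]; omega

lemma append_add_single_natAdd {n k r : ℕ} (p : Fin n → Fin k → ℝ) (w : Fin r → Fin k → ℝ)
    (F : Fin r) (v : Fin k → ℝ) :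
    Fin.append p w + Pi.single (Fin.natAdd n F) v = Fin.append p (w + Pi.single F v) := by
  funext l
  induction l using Fin.addCases with
  | left l => simp [Pi.single_apply, Fin.ext_iff]; omega
  | right l =>
    by_cases h : l = F
    · subst h; simp
    · simp [h]

lemma rowDiff_stack_castAdd {n k r : ℕ} (f : (Fin n → Fin k → ℝ) → (Fin r → Fin k → ℝ) → ℝ)
    (p : Fin n → Fin k → ℝ) (w : Fin r → Fin k → ℝ) (A : Fin n) (v : Fin k → ℝ) :
    rowDiff (stack f) (Fin.castAdd r A) v (Fin.append p w) = rowDiff (fun p' => f p' w) A v p := by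
  simp only [rowDiff, append_add_single_castAdd, stack_append]

lemma stack_momentumDiff {n k r : ℕ} (f : (Fin n → Fin k → ℝ) → (Fin r → Fin k → ℝ) → ℝ)
    (A : Fin n) : stack (momentumDiff f A) = fun M : Fin (n + r + 1) → Fin k → ℝ =>
      rowDiff (stack f) (Fin.castAdd r A) (M (Fin.last (n + r))) (fun l => M l.castSucc) := by
  funext M
  have h : (fun l => M l.castSucc) = Fin.append (fun B => M (Fin.castAdd r B).castSucc)
      (fun F => M (Fin.natAdd n F).castSucc) := by
    funext l
    induction l using Fin.addCases with
    | left l => simp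
    | right l => simp
  rw [h, rowDiff_stack_castAdd]
  rfl

lemma mmul_add_single {n k l : ℕ} (p : Fin n → Fin k → ℝ) (A : Fin n) (v : Fin k → ℝ)
    (g : Fin k → Fin l → ℝ) :
    mmul (p + Pi.single A v) g = mmul p g + Pi.single A (fun j => ∑ i, v i * g i j) := by
  funext B j
  by_cases h : B = A
  · subst h; simp [mmul, add_mul, Finset.sum_add_distrib]
  · simp [mmul, h]

lemma single_mmul {n k r : ℕ} (A : Fin n) (F : Fin r) (w : Fin r → Fin k → ℝ) :
    mmul (Pi.single A (Pi.single F 1)) w = Pi.single A (w F) := by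
  funext B j
  by_cases h : B = A
  · subst h; simp [mmul, Pi.single_apply]
  · simp [mmul, h]

lemma mmul_castSucc {n k r : ℕ} (a : Fin n → Fin (r + 1) → ℝ) (w : Fin (r + 1) → Fin k → ℝ) :
    mmul a w = mmul (fun B F => a B (Fin.castSucc F)) (fun F => w (Fin.castSucc F)) +
      fun B => a B (Fin.last r) • w (Fin.last r) := by
  funext B j
  simp [mmul, Fin.sum_univ_castSucc]

lemma mmul_diagonal {r k : ℕ} (d : Fin r → ℝ) (w : Fin r → Fin k → ℝ) :
    mmul (Matrix.diagonal d) w = fun i => d i • w i := by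
  funext i j
  simp [mmul, Matrix.diagonal_apply]

lemma mmul_transvection {r k : ℕ} (i j : Fin r) (c : ℝ) (w : Fin r → Fin k → ℝ) :
    mmul (Matrix.transvection i j c) w = w + Pi.single i (c • w j) := by
  funext l q
  by_cases h : l = i
  · subst h
    simp [mmul, Matrix.transvection, Matrix.one_apply, Matrix.single_apply, add_mul,
      Finset.sum_add_distrib]
  · simp [mmul, Matrix.transvection, Matrix.one_apply, h, Ne.symm h]

lemma mmul_assoc {a b c d : ℕ} (M : Fin a → Fin b → ℝ) (N : Fin b → Fin c → ℝ)
    (P : Fin c → Fin d → ℝ) : mmul (mmul M N) P = mmul M (mmul N P) :=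
  Matrix.mul_assoc (Matrix.of M) (Matrix.of N) (Matrix.of P)

namespace MixedAlternating

variable {n k r : ℕ} {f : (Fin n → Fin k → ℝ) → (Fin r → Fin k → ℝ) → ℝ}

lemma left (hf : MixedAlternating f) (p : Fin n → Fin k → ℝ) (w : Fin r → Fin k → ℝ)
    (h : Fin r → Fin r → ℝ) (hh : fdet h ≠ 0) : f p (mmul h w) = fdet h * f p w := by
  have key : ∀ w, f p (mmul (Matrix.of h) w) = (Matrix.of h).det * f p w := by
    refine Matrix.diagonal_transvection_induction_of_det_ne_zero
      (fun M => ∀ w, f p (mmul M w) = M.det * f p w) (Matrix.of h) hh ?_ ?_ ?_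
    · intro d hd w
      rw [Matrix.det_diagonal] at hd ⊢
      rw [mmul_diagonal]
      exact hf.diag p w d fun i => Finset.prod_ne_zero_iff.1 hd i (Finset.mem_univ i)
    · rintro ⟨i, j, hij, c⟩ w
      rw [Matrix.TransvectionStruct.det, one_mul]
      exact (congrArg (f p) (mmul_transvection i j c w)).trans (hf.transvec p w i j c hij)
    · intro M N _ _ hM hN w
      rw [Matrix.det_mul, mul_assoc, ← hN, ← hM]
      exact congrArg (f p) (mmul_assoc M N w)
  exact key w

lemma row_left (hf : MixedAlternating f) (w : Fin r → Fin k → ℝ) :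
    RowAlternating (fun p => f p w) where
  smul p A c v := by
    simp only [← rowDiff_stack_castAdd]
    exact hf.row.smul _ _ _ _
  alt p A B u v := by
    have h := hf.row.alt (Fin.append p w) (Fin.castAdd r A) (Fin.castAdd r B) u v
    simpa only [rowDiff, append_add_single_castAdd, stack_append] using h

lemma momentumDiff (hf : MixedAlternating f) (A : Fin n) :
    MixedAlternating (momentumDiff f A) where
  right p w g hg := by
    have h := mmul_add_single p A (w (Fin.last r)) g
    change f (mmul p g + Pi.single A (mmul w g (Fin.last r)))
      (mmul (fun F => w (Fin.castSucc F)) g) - f (mmul p g) (mmul (fun F => w (Fin.castSucc F)) g) = _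
    rw [show mmul w g (Fin.last r) = fun j => ∑ i, w (Fin.last r) i * g i j from rfl, ← h,
      hf.right _ _ g hg, hf.right _ _ g hg, _root_.momentumDiff, rowDiff]
    ring
  diag p w d hd := by
    simp only [_root_.momentumDiff]
    rw [(hf.row_left _).smul, Fin.prod_univ_castSucc]
    simp only [rowDiff]
    rw [hf.diag _ (fun F => w (Fin.castSucc F)) _ fun i => hd _,
      hf.diag _ (fun F => w (Fin.castSucc F)) _ fun i => hd _]
    ring
  transvec p w i j c hij := by
    induction i using Fin.lastCases with
    | last =>
      induction j using Fin.lastCases with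
      | last => exact absurd rfl hij
      | cast j =>
        have h : rowDiff (fun p' => f p' (fun F => w (Fin.castSucc F))) A
            (w (Fin.castSucc j)) p = 0 := by
          have := hf.admissible p (fun F => w (Fin.castSucc F)) (Pi.single A (Pi.single j 1))
          rw [single_mmul] at this
          exact sub_eq_zero.2 this
        rw [_root_.momentumDiff, init_add_single_last, Pi.add_apply, Pi.single_eq_same,
          (hf.row_left _).rowDiff_add, (hf.row_left _).smul, h, mul_zero, add_zero]
        rfl
    | cast i =>
      rw [_root_.momentumDiff, init_add_single_castSucc, Pi.add_apply,
        Pi.single_eq_of_ne (Fin.castSucc_lt_last i).ne', add_zero]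
      induction j using Fin.lastCases with
      | last =>
        have h := hf.row.rowDiff_add_single_smul (Fin.append p fun F => w (Fin.castSucc F))
          (Fin.castAdd r A) (Fin.natAdd n i) (w (Fin.last r)) c
        rw [append_add_single_natAdd, rowDiff_stack_castAdd, rowDiff_stack_castAdd] at h
        exact h
      | cast j =>
        simp only [rowDiff]
        have hij' : i ≠ j := fun h => hij (h ▸ rfl)
        rw [hf.transvec _ (fun F => w (Fin.castSucc F)) i j c hij',
          hf.transvec _ (fun F => w (Fin.castSucc F)) i j c hij']
        rfl
  admissible p w a := by
    rw [_root_.momentumDiff, mmul_castSucc, ← add_assoc, (hf.row_left _).rowDiff_add_smul,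
      rowDiff, add_right_comm, hf.admissible, hf.admissible]
    rfl
  row := by
    rw [stack_momentumDiff]
    exact hf.row.extend _

lemma const_mul_sum {ι : Type*} (s : Finset ι) (c : ℝ)
    {f : ι → (Fin n → Fin k → ℝ) → (Fin r → Fin k → ℝ) → ℝ}
    (hf : ∀ i, MixedAlternating (f i)) :
    MixedAlternating (fun p w => c * ∑ i ∈ s, f i p w) where
  right p w g hg := by
    simp only [(hf _).right p w g hg, ← Finset.mul_sum, mul_left_comm]
  diag p w d hd := by
    simp only [(hf _).diag p w d hd, ← Finset.mul_sum, mul_left_comm]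
  transvec p w i j d hij := by simp only [(hf _).transvec p w i j d hij]
  admissible p w a := by simp only [(hf _).admissible p w a]
  row := by
    have e : ∀ (g : ι → (Fin (n + r) → Fin k → ℝ) → ℝ) j v,
        rowDiff (fun m => c * ∑ i ∈ s, g i m) j v =
          fun m => c * ∑ i ∈ s, rowDiff (g i) j v m := by
      intro g j v
      funext m
      simp only [rowDiff, Finset.sum_sub_distrib, mul_sub]
    change RowAlternating (fun m => c * ∑ i ∈ s, stack (f i) m)
    refine ⟨fun m j d v => ?_, fun m j l u v => ?_⟩
    · simp only [e, (hf _).row.smul m j d v, ← Finset.mul_sum, mul_left_comm]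
    · simp only [e]
      rw [← mul_add, ← Finset.sum_add_distrib]
      simp only [(hf _).row.alt m j l u v, Finset.sum_const_zero, mul_zero]

end MixedAlternating

lemma pdV_eq_fderiv {a : ℕ} {f : (Fin a → ℝ) → ℝ} {x : Fin a → ℝ}
    (hf : DifferentiableAt ℝ f x) (i : Fin a) :
    pdV f i x = fderiv ℝ f x (Pi.single i 1) := by
  rw [pdV_eq_deriv, ← hf.lineDeriv_eq_fderiv, lineDeriv]

lemma pdV_congr {a : ℕ} {f g : (Fin a → ℝ) → ℝ} {U : Set (Fin a → ℝ)} (hU : IsOpen U)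
    (h : Set.EqOn f g U) {x : Fin a → ℝ} (hx : x ∈ U) (i : Fin a) : pdV f i x = pdV g i x := by
  have hc : Continuous fun t : ℝ => x + t • (Pi.single i 1 : Fin a → ℝ) := by fun_prop
  have hm : ∀ᶠ t : ℝ in nhds 0, x + t • (Pi.single i 1 : Fin a → ℝ) ∈ U :=
    hc.continuousAt.eventually_mem (hU.mem_nhds (by simpa using hx))
  rw [pdV_eq_deriv, pdV_eq_deriv]
  exact Filter.EventuallyEq.deriv_eq (hm.mono fun t ht => h ht)

lemma pdV_const_mul {a : ℕ} (c : ℝ) (f : (Fin a → ℝ) → ℝ) (i : Fin a) (x : Fin a → ℝ) :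
    pdV (fun x => c * f x) i x = c * pdV f i x := by
  simp only [pdV, deriv_const_mul_field]

lemma pdV_sub {a : ℕ} {f g : (Fin a → ℝ) → ℝ} {x : Fin a → ℝ}
    (hf : DifferentiableAt ℝ f x) (hg : DifferentiableAt ℝ g x) (i : Fin a) :
    pdV (fun x => f x - g x) i x = pdV f i x - pdV g i x := by
  rw [pdV_eq_fderiv hf, pdV_eq_fderiv hg, pdV_eq_fderiv (hf.fun_sub hg), fderiv_fun_sub hf hg,
    sub_apply]

lemma pdV_sum {a : ℕ} {ι : Type*} (s : Finset ι) {f : ι → (Fin a → ℝ) → ℝ} {x : Fin a → ℝ}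
    (hf : ∀ j ∈ s, DifferentiableAt ℝ (f j) x) (i : Fin a) :
    pdV (fun x => ∑ j ∈ s, f j x) i x = ∑ j ∈ s, pdV (f j) i x := by
  rw [pdV_eq_fderiv (DifferentiableAt.fun_sum hf), fderiv_fun_sum hf, sum_apply]
  exact Finset.sum_congr rfl fun j hj => (pdV_eq_fderiv (hf j hj) i).symm

lemma contDiffOn_pdV {a : ℕ} {f : (Fin a → ℝ) → ℝ} {U : Set (Fin a → ℝ)} (hU : IsOpen U)
    (hf : ContDiffOn ℝ (⊤ : ℕ∞) f U) (i : Fin a) : ContDiffOn ℝ (⊤ : ℕ∞) (pdV f i) U := by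
  have h : ContDiffOn ℝ (⊤ : ℕ∞) (fun x => fderiv ℝ f x (Pi.single i 1)) U :=
    (hf.fderiv_of_isOpen hU (by simp)).clm_apply contDiffOn_const
  exact h.congr fun x hx => pdV_eq_fderiv
    ((hf.differentiableOn (by simp)).differentiableAt (hU.mem_nhds hx)) i

lemma pdV_comm {a : ℕ} {f : (Fin a → ℝ) → ℝ} {U : Set (Fin a → ℝ)} (hU : IsOpen U)
    (hf : ContDiffOn ℝ (⊤ : ℕ∞) f U) {x : Fin a → ℝ} (hx : x ∈ U) (i j : Fin a) :
    pdV (pdV f i) j x = pdV (pdV f j) i x := by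
  have hd : DifferentiableAt ℝ (fderiv ℝ f) x :=
    ((hf.fderiv_of_isOpen hU (m := (⊤ : ℕ∞)) (by simp)).differentiableOn
      (by simp)).differentiableAt (hU.mem_nhds hx)
  have key : ∀ i j, pdV (pdV f i) j x =
      fderiv ℝ (fderiv ℝ f) x (Pi.single j 1) (Pi.single i 1) := by
    intro i j
    have e : Set.EqOn (pdV f i) (fun y => fderiv ℝ f y (Pi.single i 1)) U := fun y hy =>
      pdV_eq_fderiv ((hf.differentiableOn (by simp)).differentiableAt (hU.mem_nhds hy)) i
    rw [pdV_congr hU e hx, pdV_eq_fderiv (hd.clm_apply (differentiableAt_const _)),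
      fderiv_clm_apply hd (differentiableAt_const _)]
    simp
  have hs : IsSymmSndFDerivAt ℝ f x := (hf.contDiffAt (hU.mem_nhds hx)).isSymmSndFDerivAt
    (by rw [minSmoothness_of_isRCLikeNormedField]; exact WithTop.coe_le_coe.2 le_top)
  rw [key, key]
  exact hs _ _

lemma contDiffOn_pdV_prod {a : ℕ} {E : Type*} [NormedAddCommGroup E] [NormedSpace ℝ E]
    {f : (Fin a → ℝ) → E → ℝ} {U : Set (Fin a → ℝ)} (hU : IsOpen U)
    (hf : ContDiffOn ℝ (⊤ : ℕ∞) (fun q : (Fin a → ℝ) × E => f q.1 q.2) (U ×ˢ Set.univ))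
    (i : Fin a) :
    ContDiffOn ℝ (⊤ : ℕ∞) (fun q : (Fin a → ℝ) × E => pdV (fun x => f x q.2) i q.1)
      (U ×ˢ Set.univ) := by
  have hV : IsOpen (U ×ˢ (Set.univ : Set E)) := hU.prod isOpen_univ
  have h : ContDiffOn ℝ (⊤ : ℕ∞) (fun q : (Fin a → ℝ) × E =>
      fderiv ℝ (fun q : (Fin a → ℝ) × E => f q.1 q.2) q (Pi.single i 1, 0)) (U ×ˢ Set.univ) :=
    (hf.fderiv_of_isOpen hV (by simp)).clm_apply contDiffOn_const
  refine h.congr fun q hq => ?_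
  have hd := (hf.differentiableOn (by simp)).differentiableAt (hV.mem_nhds hq)
  rw [pdV_eq_deriv, ← hd.lineDeriv_eq_fderiv, lineDeriv]
  simp

lemma RowAlternating.pdV {a b n : ℕ} {U : Set (Fin n → ℝ)} (hU : IsOpen U)
    {G : (Fin n → ℝ) → (Fin a → Fin b → ℝ) → ℝ} (hG : ∀ x ∈ U, RowAlternating (G x))
    (hd : ∀ m, DifferentiableOn ℝ (fun x => G x m) U) {x : Fin n → ℝ} (hx : x ∈ U) (A : Fin n) :
    RowAlternating (fun m => pdV (fun x' => G x' m) A x) := by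
  have hda : ∀ m, DifferentiableAt ℝ (fun x => G x m) x :=
    fun m => (hd m).differentiableAt (hU.mem_nhds hx)
  have e : ∀ i v, rowDiff (fun m => _root_.pdV (fun x' => G x' m) A x) i v =
      fun m => _root_.pdV (fun x' => rowDiff (G x') i v m) A x := by
    intro i v
    funext m
    exact (pdV_sub (hda _) (hda _) A).symm
  have e₂ : ∀ i j v u m, rowDiff (fun m => _root_.pdV (fun x' => rowDiff (G x') i v m) A x) j u m =
      _root_.pdV (fun x' => rowDiff (rowDiff (G x') i v) j u m) A x := by
    intro i j v u m
    exact (pdV_sub ((hda _).sub (hda _)) ((hda _).sub (hda _)) A).symm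
  refine ⟨fun m i c v => ?_, fun m i j u v => ?_⟩
  · rw [e, e, ← pdV_const_mul]
    exact pdV_congr hU (fun y hy => (hG y hy).smul m i c v) hx A
  · rw [e, e, e₂, e₂, ← sub_neg_eq_add, sub_eq_zero, ← neg_one_mul, ← pdV_const_mul]
    refine pdV_congr hU (fun y hy => ?_) hx A
    have := (hG y hy).alt m i j u v
    linarith

lemma MixedAlternating.pdV {n k r : ℕ} {U : Set (Fin n → ℝ)} (hU : IsOpen U)
    {F : (Fin n → ℝ) → (Fin n → Fin k → ℝ) → (Fin r → Fin k → ℝ) → ℝ}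
    (hF : ∀ x ∈ U, MixedAlternating (F x))
    (hd : ∀ p w, DifferentiableOn ℝ (fun x => F x p w) U) {x : Fin n → ℝ} (hx : x ∈ U)
    (A : Fin n) :
    MixedAlternating (fun p w => pdV (fun x' => F x' p w) A x) where
  right p w g hg := by
    rw [← pdV_const_mul]
    exact pdV_congr hU (fun y hy => (hF y hy).right p w g hg) hx A
  diag p w d hd := by
    rw [← pdV_const_mul]
    exact pdV_congr hU (fun y hy => (hF y hy).diag p w d hd) hx A
  transvec p w i j c hij := pdV_congr hU (fun y hy => (hF y hy).transvec p w i j c hij) hx A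
  admissible p w a := pdV_congr hU (fun y hy => (hF y hy).admissible p w a) hx A
  row := RowAlternating.pdV hU (fun y hy => (hF y hy).row) (fun _ => hd _ _) hx A

lemma fdet_diagonal {r : ℕ} (d : Fin r → ℝ) : fdet (Matrix.diagonal d) = ∏ i, d i :=
  Matrix.det_diagonal

lemma fdet_transvection {r : ℕ} {i j : Fin r} (hij : i ≠ j) (c : ℝ) :
    fdet (Matrix.transvection i j c) = 1 :=
  Matrix.det_transvection_of_ne i j hij c

namespace IsMixedForm

variable {n k r : ℕ} {U : Set (Fin n → ℝ)}
  {L : (Fin n → ℝ) → (Fin n → Fin k → ℝ) → (Fin r → Fin k → ℝ) → ℝ}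

lemma mixedAlternating (hL : IsMixedForm U L) {x : Fin n → ℝ} (hx : x ∈ U) :
    MixedAlternating (L x) where
  right := hL.2.1 x hx
  diag p w d hd := by
    have h := hL.2.2.1 x hx p w (Matrix.diagonal d)
    rw [fdet_diagonal, mmul_diagonal] at h
    exact h (Finset.prod_ne_zero_iff.2 fun i _ => hd i)
  transvec p w i j c hij := by
    have h := hL.2.2.1 x hx p w (Matrix.transvection i j c)
    rw [fdet_transvection hij, mmul_transvection, one_mul] at h
    exact h one_ne_zero
  admissible := hL.2.2.2.1 x hx
  row := by
    refine FundEqs.rowAlternating (f := stack (L x)) (hL.2.2.2.2 x hx) ?_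
    have h : ContDiff ℝ (⊤ : ℕ∞) (fun m : Fin (n + r) → Fin k → ℝ => stack (L x) m) := by
      rw [← contDiffOn_univ]
      exact hL.1.comp (f := fun m : Fin (n + r) → Fin k → ℝ =>
          (x, fun A => m (Fin.castAdd r A), fun F => m (Fin.natAdd n F)))
        (by fun_prop) fun m _ => ⟨hx, Set.mem_univ _⟩
    exact h.of_le (WithTop.coe_le_coe.2 le_top)

lemma of_mixedAlternating
    (hs : ContDiffOn ℝ (⊤ : ℕ∞)
      (fun q : (Fin n → ℝ) × (Fin n → Fin k → ℝ) × (Fin r → Fin k → ℝ) => L q.1 q.2.1 q.2.2)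
      (U ×ˢ Set.univ))
    (h : ∀ x ∈ U, MixedAlternating (L x)) : IsMixedForm U L :=
  ⟨hs, fun x hx => (h x hx).right, fun x hx => (h x hx).left, fun x hx => (h x hx).admissible,
    fun x hx => (h x hx).row.fundEqs⟩

lemma contDiffOn_left (hL : IsMixedForm U L) (p : Fin n → Fin k → ℝ) (w : Fin r → Fin k → ℝ) :
    ContDiffOn ℝ (⊤ : ℕ∞) (fun x => L x p w) U :=
  hL.1.comp (f := fun x => (x, p, w)) (by fun_prop) fun _ hx => ⟨hx, Set.mem_univ _⟩

lemma contDiffOn_momentumDiff (hL : IsMixedForm U L) (A : Fin n) :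
    ContDiffOn ℝ (⊤ : ℕ∞)
      (fun q : (Fin n → ℝ) × (Fin n → Fin k → ℝ) × (Fin (r + 1) → Fin k → ℝ) =>
        momentumDiff (L q.1) A q.2.1 q.2.2) (U ×ˢ Set.univ) := by
  refine ContDiffOn.sub ?_ ?_
  · have hsingle : ContDiff ℝ (⊤ : ℕ∞) (fun v : Fin k → ℝ => (Pi.single A v : Fin n → Fin k → ℝ)) :=
      (ContinuousLinearMap.single ℝ (fun _ : Fin n => Fin k → ℝ) A).contDiff
    refine hL.1.comp (s := U ×ˢ Set.univ) (f := fun q : (Fin n → ℝ) × (Fin n → Fin k → ℝ) ×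
        (Fin (r + 1) → Fin k → ℝ) =>
      (q.1, q.2.1 + Pi.single A (q.2.2 (Fin.last r)), fun F => q.2.2 (Fin.castSucc F)))
      (ContDiff.contDiffOn ?_) fun q hq => ⟨hq.1, Set.mem_univ _⟩
    refine contDiff_fst.prodMk (ContDiff.prodMk (ContDiff.add (by fun_prop) ?_) (by fun_prop))
    exact hsingle.comp (by fun_prop)
  · exact hL.1.comp (f := fun q : (Fin n → ℝ) × (Fin n → Fin k → ℝ) ×
        (Fin (r + 1) → Fin k → ℝ) => (q.1, q.2.1, fun F => q.2.2 (Fin.castSucc F)))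
      (by fun_prop) fun q hq => ⟨hq.1, Set.mem_univ _⟩

lemma contDiffOn_momentumDiff_left (hL : IsMixedForm U L) (A : Fin n) (p : Fin n → Fin k → ℝ)
    (w : Fin (r + 1) → Fin k → ℝ) :
    ContDiffOn ℝ (⊤ : ℕ∞) (fun x => momentumDiff (L x) A p w) U :=
  (hL.contDiffOn_left _ _).sub (hL.contDiffOn_left _ _)

/-- Since a mixed form is affine in each row of `p`, its differential is a divergence of
increments. -/
lemma Dmix_eq (hU : IsOpen U) (hL : IsMixedForm U L) {x : Fin n → ℝ} (hx : x ∈ U)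
    (p : Fin n → Fin k → ℝ) (w : Fin (r + 1) → Fin k → ℝ) :
    Dmix L x p w = (-1) ^ r * ∑ A, pdV (fun x' => momentumDiff (L x') A p w) A x := by
  have hd : ∀ p w, DifferentiableAt ℝ (fun x => L x p w) x := fun p w =>
    ((hL.contDiffOn_left p w).differentiableOn (by simp)).differentiableAt (hU.mem_nhds hx)
  rw [Dmix, Finset.sum_comm]
  congr 1
  refine Finset.sum_congr rfl fun A _ => ?_
  have h₁ : ∀ K, pdV (fun x' => pdM (fun p' => L x' p' (fun F => w (Fin.castSucc F))) A K p) A x =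
      pdV (fun x' => rowDiff (fun p' => L x' p' (fun F => w (Fin.castSucc F))) A
        (Pi.single K 1) p) A x := fun K =>
    pdV_congr hU (fun y hy => ((hL.mixedAlternating hy).row_left _).pdM_eq_rowDiff A K p) hx A
  have h₂ : Set.EqOn (fun x' => momentumDiff (L x') A p w)
      (fun x' => ∑ K, w (Fin.last r) K *
        rowDiff (fun p' => L x' p' (fun F => w (Fin.castSucc F))) A (Pi.single K 1) p) U :=
    fun y hy => ((hL.mixedAlternating hy).row_left _).rowDiff_eq_sum A _ p
  have hd' : ∀ K, DifferentiableAt ℝ (fun x' => w (Fin.last r) K *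
      rowDiff (fun p' => L x' p' (fun F => w (Fin.castSucc F))) A (Pi.single K 1) p) x :=
    fun K => ((hd _ _).sub (hd _ _)).const_mul _
  rw [pdV_congr hU h₂ hx, pdV_sum _ fun K _ => hd' K]
  simp only [h₁, pdV_const_mul]

lemma isMixedForm_Dmix (hU : IsOpen U) (hL : IsMixedForm U L) : IsMixedForm U (Dmix L) := by
  refine of_mixedAlternating ?_ fun x hx => ?_
  · refine ContDiffOn.congr ?_ fun q hq => hL.Dmix_eq hU hq.1 q.2.1 q.2.2
    refine contDiffOn_const.mul (ContDiffOn.sum fun A _ => ?_)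
    exact contDiffOn_pdV_prod (f := fun x (e : (Fin n → Fin k → ℝ) × (Fin (r + 1) → Fin k → ℝ)) =>
      momentumDiff (L x) A e.1 e.2) hU (hL.contDiffOn_momentumDiff A) A
  · rw [show Dmix L x = _ from funext fun p => funext fun w => hL.Dmix_eq hU hx p w]
    exact MixedAlternating.const_mul_sum _ _ fun A => MixedAlternating.pdV hU
      (fun y hy => (hL.mixedAlternating hy).momentumDiff A)
      (fun p w => (hL.contDiffOn_momentumDiff_left A p w).differentiableOn (by simp)) hx A

lemma Dmix_Dmix (hU : IsOpen U) (hL : IsMixedForm U L) {x : Fin n → ℝ} (hx : x ∈ U)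
    (p : Fin n → Fin k → ℝ) (W : Fin (r + 2) → Fin k → ℝ) : Dmix (Dmix L) x p W = 0 := by
  let w : Fin (r + 1) → Fin k → ℝ := fun F => W (Fin.castSucc F)
  let S : Fin n → Fin n → (Fin n → ℝ) → ℝ := fun A B y =>
    rowDiff (fun p' => momentumDiff (L y) A p' w) B (W (Fin.last (r + 1))) p
  have hS : ∀ A B, ContDiffOn ℝ (⊤ : ℕ∞) (S A B) U := fun A B =>
    (hL.contDiffOn_momentumDiff_left A _ _).sub (hL.contDiffOn_momentumDiff_left A _ _)
  have hanti : ∀ A B, Set.EqOn (S B A) (fun y => -1 * S A B y) U := by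
    intro A B y hy
    have := ((hL.mixedAlternating hy).row_left fun F => w (Fin.castSucc F)).alt p A B
      (w (Fin.last r)) (W (Fin.last (r + 1)))
    change rowDiff (rowDiff _ B _) A _ p = -1 * rowDiff (rowDiff _ A _) B _ p
    linarith
  have hinner : ∀ B, Set.EqOn (fun y => momentumDiff (Dmix L y) B p W)
      (fun y => (-1) ^ r * ∑ A, pdV (S A B) A y) U := by
    intro B y hy
    have hd : ∀ A p w, DifferentiableAt ℝ (fun x => momentumDiff (L x) A p w) y := fun A p w =>
      ((hL.contDiffOn_momentumDiff_left A p w).differentiableOn (by simp)).differentiableAt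
        (hU.mem_nhds hy)
    change Dmix L y (p + Pi.single B _) w - Dmix L y p w = _
    rw [hL.Dmix_eq hU hy, hL.Dmix_eq hU hy, ← mul_sub, ← Finset.sum_sub_distrib]
    congr 1
    exact Finset.sum_congr rfl fun A _ => (pdV_sub (hd A _ _) (hd A _ _) A).symm
  have hdiff : ∀ A B, DifferentiableAt ℝ (pdV (S A B) A) x := fun A B =>
    ((contDiffOn_pdV hU (hS A B) A).differentiableOn (by simp)).differentiableAt (hU.mem_nhds hx)
  have houter : ∀ B, pdV (fun y => momentumDiff (Dmix L y) B p W) B x =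
      (-1) ^ r * ∑ A, pdV (pdV (S A B) A) B x := by
    intro B
    rw [pdV_congr hU (hinner B) hx, pdV_const_mul, pdV_sum _ fun A _ => hdiff A B]
  have hskew : ∀ A B, pdV (pdV (S B A) B) A x = -pdV (pdV (S A B) A) B x := by
    intro A B
    have h : Set.EqOn (pdV (S B A) B) (fun y => -1 * pdV (S A B) B y) U := fun y hy => by
      rw [pdV_congr hU (hanti A B) hy, pdV_const_mul]
    rw [pdV_congr hU h hx, pdV_const_mul, pdV_comm hU (hS A B) hx, neg_one_mul]
  have hsum : ∑ B, ∑ A, pdV (pdV (S A B) A) B x = 0 := by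
    have h : ∑ B, ∑ A, pdV (pdV (S A B) A) B x = -∑ B, ∑ A, pdV (pdV (S A B) A) B x := by
      refine Finset.sum_comm.trans ?_
      simp only [← Finset.sum_neg_distrib]
      exact Finset.sum_congr rfl fun A _ => Finset.sum_congr rfl fun B _ => hskew B A
    linarith
  rw [(hL.isMixedForm_Dmix hU).Dmix_eq hU hx]
  simp only [houter, ← Finset.mul_sum, hsum, mul_zero]

end IsMixedForm

/-- The differential `Δ𝓛` of an even mixed form `𝓛` of codegree
`k` and additional degree `r` on `U` is an even mixed form of codegree `k` and
additional degree `r+1` on `U`, and `Δ(Δ𝓛) = 0`. -/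
theorem statement_17 (n k r : ℕ) (U : Set (Fin n → ℝ)) (hU : IsOpen U)
    (L : (Fin n → ℝ) → (Fin n → Fin k → ℝ) → (Fin r → Fin k → ℝ) → ℝ)
    (hL : IsMixedForm U L) :
    IsMixedForm U (Dmix L) ∧
    ∀ x ∈ U, ∀ (p : Fin n → Fin k → ℝ) (W : Fin (r + 2) → Fin k → ℝ),
      Dmix (Dmix L) x p W = 0 :=
  ⟨hL.isMixedForm_Dmix hU, fun _ hx p W => hL.Dmix_Dmix hU hx p W⟩
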